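/- Let 0 < η₁ < α₁, m = η₁/α₁, and c₁ = −α₁² + α₁²·E(m)/K(m). Then ∫_{−η₁}^{η₁} (ζ² + c₁)/√((η₁² − ζ²)(α₁² − ζ²)) dζ = 0. -/

import Mathlib

open Real

/-- The complete elliptic integral of the first kind,
`K(m) = ∫₀^{π/2} dθ/√(1 − m² sin²θ)`. -/
noncomputable def ellipticK (m : ℝ) : ℝ :=
  ∫ θ in (0:ℝ)..(π / 2), 1 / Real.sqrt (1 - m ^ 2 * Real.sin θ ^ 2)

/-- The complete elliptic integral of the second kind,
`E(m) = ∫₀^{π/2} √(1 − m² sin²θ) dθ`. -/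
noncomputable def ellipticE (m : ℝ) : ℝ :=
  ∫ θ in (0:ℝ)..(π / 2), Real.sqrt (1 - m ^ 2 * Real.sin θ ^ 2)

/-- The substitution `ζ = r sin θ`, valid for every integrand `g`. -/
theorem integral_neg_eq_integral_comp_mul_sin (g : ℝ → ℝ) {r : ℝ} (hr : 0 < r) :
    ∫ ζ in (-r)..r, g ζ =
      ∫ θ in Set.Ioo (-(π / 2)) (π / 2), (r * Real.cos θ) * g (r * Real.sin θ) := by
  have himg : (fun θ => r * Real.sin θ) '' Set.Ioo (-(π / 2)) (π / 2) = Set.Ioo (-r) r := by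
    ext x
    constructor
    · rintro ⟨θ, hθ, rfl⟩
      have hc := Real.cos_pos_of_mem_Ioo hθ
      have hsq := Real.sin_sq_add_cos_sq θ
      have hs : Real.sin θ < 1 := by nlinarith
      have hs' : -1 < Real.sin θ := by nlinarith
      constructor <;> dsimp only <;> nlinarith
    · rintro ⟨hx, hx'⟩
      have h1 : -1 < x / r := by rw [lt_div_iff₀ hr]; linarith
      have h2 : x / r < 1 := by rw [div_lt_iff₀ hr]; linarith
      refine ⟨Real.arcsin (x / r),
        ⟨Real.neg_pi_div_two_lt_arcsin.2 h1, Real.arcsin_lt_pi_div_two.2 h2⟩, ?_⟩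
      dsimp only
      rw [Real.sin_arcsin h1.le h2.le]
      field_simp
  rw [intervalIntegral.integral_of_le (by linarith), MeasureTheory.integral_Ioc_eq_integral_Ioo,
    ← himg, MeasureTheory.integral_image_eq_integral_abs_deriv_smul measurableSet_Ioo
      (fun θ _ => ((Real.hasDerivAt_sin θ).const_mul r).hasDerivWithinAt)]
  · refine MeasureTheory.setIntegral_congr_fun measurableSet_Ioo fun θ hθ => ?_
    rw [abs_of_pos (mul_pos hr (Real.cos_pos_of_mem_Ioo hθ)), smul_eq_mul]
  · intro a ha b hb hab
    exact Real.injOn_sin (Set.Ioo_subset_Icc_self ha) (Set.Ioo_subset_Icc_self hb)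
      (mul_left_cancel₀ hr.ne' hab)

theorem one_sub_sq_mul_sin_sq_pos {m : ℝ} (hm : m ^ 2 < 1) (θ : ℝ) :
    0 < 1 - m ^ 2 * Real.sin θ ^ 2 := by
  nlinarith [Real.sin_sq_le_one θ, sq_nonneg m]

theorem continuous_one_div_sqrt_one_sub_sq_mul_sin_sq {m : ℝ} (hm : m ^ 2 < 1) :
    Continuous fun θ : ℝ => 1 / Real.sqrt (1 - m ^ 2 * Real.sin θ ^ 2) :=
  continuous_const.div (by fun_prop)
    fun θ => (Real.sqrt_pos.2 (one_sub_sq_mul_sin_sq_pos hm θ)).ne'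

theorem ellipticK_pos {m : ℝ} (hm : m ^ 2 < 1) : 0 < ellipticK m :=
  intervalIntegral.intervalIntegral_pos_of_pos
    ((continuous_one_div_sqrt_one_sub_sq_mul_sin_sq hm).intervalIntegrable _ _)
    (fun θ => one_div_pos.2 (Real.sqrt_pos.2 (one_sub_sq_mul_sin_sq_pos hm θ)))
    (by positivity)

/-- The integral of a continuous even function over a symmetric interval. -/
theorem integral_neg_eq_two_mul_of_even {f : ℝ → ℝ} (hf : Continuous f)
    (heven : ∀ x, f (-x) = f x) (a : ℝ) :
    ∫ x in (-a)..a, f x = 2 * ∫ x in (0:ℝ)..a, f x := by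
  have h : ∫ x in (-a)..0, f x = ∫ x in (0:ℝ)..a, f x := by
    simpa [heven] using (intervalIntegral.integral_comp_neg (a := 0) (b := a) f).symm
  rw [← intervalIntegral.integral_add_adjacent_intervals (hf.intervalIntegrable (-a) 0)
    (hf.intervalIntegrable 0 a), h, two_mul]

/-- Normalization condition for `Q_{α₁,1}(λ) = λ² + c₁` with
`c₁ = −α₁² + α₁² E(m)/K(m)`, `m = η₁/α₁`:
`∫_{−η₁}^{η₁} (ζ² + c₁)/√((η₁² − ζ²)(α₁² − ζ²)) dζ = 0`. -/
theorem Q1_normalization (η₁ α₁ : ℝ) (h₀ : 0 < η₁) (h₁ : η₁ < α₁) :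
    ∫ ζ in (-η₁)..η₁,
        (ζ ^ 2 + (-α₁ ^ 2 + α₁ ^ 2 * ellipticE (η₁ / α₁) / ellipticK (η₁ / α₁)))
          / Real.sqrt ((η₁ ^ 2 - ζ ^ 2) * (α₁ ^ 2 - ζ ^ 2)) = 0 := by
  have hα : 0 < α₁ := h₀.trans h₁
  set m := η₁ / α₁ with hmdef
  have hη : η₁ = α₁ * m := by rw [hmdef]; field_simp
  have hm0 : 0 < m := div_pos h₀ hα
  have hm1 : m < 1 := (div_lt_one hα).2 h₁
  have hm : m ^ 2 < 1 := by nlinarith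
  have hK := ellipticK_pos hm
  have hcK := continuous_one_div_sqrt_one_sub_sq_mul_sin_sq hm
  have hcE : Continuous fun θ : ℝ => Real.sqrt (1 - m ^ 2 * Real.sin θ ^ 2) := by fun_prop
  rw [integral_neg_eq_integral_comp_mul_sin _ h₀]
  have key : ∀ θ ∈ Set.Ioo (-(π / 2)) (π / 2),
      η₁ * Real.cos θ * (((η₁ * Real.sin θ) ^ 2
          + (-α₁ ^ 2 + α₁ ^ 2 * ellipticE m / ellipticK m))
        / Real.sqrt ((η₁ ^ 2 - (η₁ * Real.sin θ) ^ 2) * (α₁ ^ 2 - (η₁ * Real.sin θ) ^ 2)))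
      = α₁ * (ellipticE m / ellipticK m * (1 / Real.sqrt (1 - m ^ 2 * Real.sin θ ^ 2))
        - Real.sqrt (1 - m ^ 2 * Real.sin θ ^ 2)) := by
    intro θ hθ
    have hc := Real.cos_pos_of_mem_Ioo hθ
    have hp := one_sub_sq_mul_sin_sq_pos hm θ
    have hs := Real.sqrt_pos.2 hp
    have hsq := Real.sq_sqrt hp.le
    have hroot : Real.sqrt ((η₁ ^ 2 - (η₁ * Real.sin θ) ^ 2) * (α₁ ^ 2 - (η₁ * Real.sin θ) ^ 2))
        = η₁ * Real.cos θ * α₁ * Real.sqrt (1 - m ^ 2 * Real.sin θ ^ 2) := by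
      rw [← Real.sqrt_sq (by positivity : 0 ≤ η₁ * Real.cos θ * α₁),
        ← Real.sqrt_mul (by positivity)]
      congr 1
      rw [mul_pow _ α₁, mul_pow _ (Real.cos θ), Real.cos_sq', hη]
      ring
    rw [hroot]
    have hnum : (η₁ * Real.sin θ) ^ 2 + (-α₁ ^ 2 + α₁ ^ 2 * ellipticE m / ellipticK m)
        = α₁ ^ 2 * (ellipticE m / ellipticK m - Real.sqrt (1 - m ^ 2 * Real.sin θ ^ 2) ^ 2) := by
      rw [hsq, hη]
      ring
    rw [hnum]
    field_simp
  rw [MeasureTheory.setIntegral_congr_fun measurableSet_Ioo key,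
    ← MeasureTheory.integral_Ioc_eq_integral_Ioo,
    ← intervalIntegral.integral_of_le (by linarith [Real.pi_pos]),
    integral_neg_eq_two_mul_of_even (by fun_prop) (fun θ => by simp only [Real.sin_neg, neg_sq]),
    intervalIntegral.integral_const_mul,
    intervalIntegral.integral_sub ((hcK.const_mul _).intervalIntegrable _ _)
      (hcE.intervalIntegrable _ _),
    intervalIntegral.integral_const_mul]
  change 2 * (α₁ * (ellipticE m / ellipticK m * ellipticK m - ellipticE m)) = 0
  rw [div_mul_cancel₀ _ hK.ne', sub_self, mul_zero, mul_zero]
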